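/- For the controlled male-abundance system dI/dt = b(1 - I/K)F - (ν_I + μ_I)I, dY/dt = rν_I I - (ν_Y+μ_Y)Y + δF, dF/dt = ν_Y Y - (δ + μ_F)F, dM/dt = (1 - r)ν_I I - (μ_M + αY_P/(Y+Y_P))M: (a) it defines a positive dynamical system on ℝ⁴₊; (b) under N₀ > 1 and Y* < γM*, it has a positive equilibrium EE^# = (I*, Y*, F*, M^#(Y_P)) with M^#(Y_P) = (1-r)ν_I(Y*+Y_P)I* / (μ_M(Y*+Y_P) + αY_P) = M*/(1 + αY_P/(μ_M(Y*+Y_P))), which is globally asymptotically stable on ℝ⁴₊ \ {x ∈ ℝ⁴₊ : I = Y = F = 0}. -/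

import Mathlib

open Filter Topology Set

noncomputable section

/-- `x` is a (forward) solution of `x' = f x` for `t ≥ 0` remaining in `S`. -/
def IsSolOn (f : (Fin 4 → ℝ) → (Fin 4 → ℝ)) (S : Set (Fin 4 → ℝ))
    (x : ℝ → Fin 4 → ℝ) : Prop :=
  (∀ t : ℝ, 0 ≤ t → HasDerivAt x (f (x t)) t) ∧ ∀ t : ℝ, 0 ≤ t → x t ∈ S

/-- The nonnegative orthant ℝ⁴₊. -/
def Orthant : Set (Fin 4 → ℝ) := {x | ∀ i, 0 ≤ x i}

/-- `f` defines a positive dynamical system on `S`. -/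
def PositiveDynSys (f : (Fin 4 → ℝ) → (Fin 4 → ℝ)) (S : Set (Fin 4 → ℝ)) : Prop :=
  ∀ x₀ ∈ S, ∃ x : ℝ → Fin 4 → ℝ, x 0 = x₀ ∧ IsSolOn f S x ∧
    ∀ y : ℝ → Fin 4 → ℝ, y 0 = x₀ → IsSolOn f S y → ∀ t : ℝ, 0 ≤ t → y t = x t

/-- Lyapunov stability of `p` relative to forward solutions in `S`. -/
def StableOn (f : (Fin 4 → ℝ) → (Fin 4 → ℝ)) (S : Set (Fin 4 → ℝ)) (p : Fin 4 → ℝ) : Prop :=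
  ∀ ε > 0, ∃ d > 0, ∀ x : ℝ → Fin 4 → ℝ, IsSolOn f S x → dist (x 0) p < d →
    ∀ t : ℝ, 0 ≤ t → dist (x t) p < ε

/-- `p` is a globally asymptotically stable equilibrium of `f` on `S`. -/
def GASOn (f : (Fin 4 → ℝ) → (Fin 4 → ℝ)) (S : Set (Fin 4 → ℝ)) (p : Fin 4 → ℝ) : Prop :=
  f p = 0 ∧ StableOn f S p ∧
    ∀ x : ℝ → Fin 4 → ℝ, IsSolOn f S x → Tendsto x atTop (𝓝 p)

/-- The vector field of the controlled male-abundance system (pheromone strength `YP`,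
trapping rate `α`). -/
def cAbund (b K r νI μI νY μY δ μF μM α YP : ℝ) : (Fin 4 → ℝ) → (Fin 4 → ℝ) := fun x =>
  ![b * (1 - x 0 / K) * x 2 - (νI + μI) * x 0,
    r * νI * x 0 - (νY + μY) * x 1 + δ * x 2,
    νY * x 1 - (δ + μF) * x 2,
    (1 - r) * νI * x 0 - (μM + α * YP / (x 1 + YP)) * x 3]


lemma barrier {u u' : ℝ → ℝ} {T C : ℝ} (hu : ∀ t, T ≤ t → HasDerivAt u (u' t) t)
    (h0 : u T ≤ C) (h : ∀ t, T ≤ t → C < u t → u' t ≤ 0) : ∀ t, T ≤ t → u t ≤ C := by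
  intro t1 ht1
  by_contra hcon
  push Not at hcon
  have hcont : ContinuousOn u (Icc T t1) := fun t ht => (hu t ht.1).continuousAt.continuousWithinAt
  have hcl : IsClosed (Icc T t1 ∩ u ⁻¹' (Iic C)) :=
    hcont.preimage_isClosed_of_isClosed isClosed_Icc isClosed_Iic
  have hcomp : IsCompact (Icc T t1 ∩ u ⁻¹' (Iic C)) :=
    isCompact_Icc.of_isClosed_subset hcl inter_subset_left
  obtain ⟨s, ⟨⟨hs1, hs2⟩, hs3⟩, hmax⟩ :=
    hcomp.exists_isGreatest ⟨T, ⟨le_refl _, ht1⟩, h0⟩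
  have hanti : AntitoneOn u (Icc s t1) := by
    apply antitoneOn_of_deriv_nonpos (convex_Icc s t1)
    · exact hcont.mono (Icc_subset_Icc_left hs1)
    · intro t ht
      rw [interior_Icc] at ht
      exact (hu t (hs1.trans ht.1.le)).differentiableAt.differentiableWithinAt
    · intro t ht
      rw [interior_Icc] at ht
      rw [(hu t (hs1.trans ht.1.le)).deriv]
      apply h t (hs1.trans ht.1.le)
      by_contra hle
      push Not at hle
      have := hmax ⟨⟨hs1.trans ht.1.le, ht.2.le⟩, hle⟩
      linarith [ht.1]
  have := hanti ⟨le_refl _, hs2⟩ ⟨hs2, le_refl _⟩ hs2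
  have h3 : u s ≤ C := hs3
  linarith

lemma barrier_ge {u u' : ℝ → ℝ} {T C : ℝ} (hu : ∀ t, T ≤ t → HasDerivAt u (u' t) t)
    (h0 : C ≤ u T) (h : ∀ t, T ≤ t → u t < C → 0 ≤ u' t) : ∀ t, T ≤ t → C ≤ u t := by
  intro t ht
  have := barrier (u := fun t => - u t) (u' := fun t => - u' t) (T := T) (C := -C)
    (fun t ht => (hu t ht).neg) (by simpa using h0)
    (fun t ht hlt => by
      have := h t ht (by linarith)
      linarith) t ht
  linarith

lemma global_exists (g : (Fin 4 → ℝ) → (Fin 4 → ℝ)) (k L : NNReal) (hg : LipschitzWith k g)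
    (hL : ∀ x, ‖g x‖ ≤ L) (x₀ : Fin 4 → ℝ) :
    ∃ x : ℝ → Fin 4 → ℝ, x 0 = x₀ ∧ ∀ t, HasDerivAt x (g (x t)) t := by
  have key : ∀ n : ℕ, ∃ x : ℝ → Fin 4 → ℝ, x 0 = x₀ ∧
      ∀ t ∈ Icc (-(n+1 : ℝ)) (n+1), HasDerivWithinAt x (g (x t)) (Icc (-(n+1 : ℝ)) (n+1)) t := by
    intro n
    have hn : (0:ℝ) ≤ n := Nat.cast_nonneg n
    have hpl : IsPicardLindelof (fun _ => g) (tmin := -(n+1 : ℝ)) (tmax := n+1)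
        ⟨0, by constructor <;> linarith⟩ x₀ (L * (n+1)) 0 L k :=
      { lipschitzOnWith := fun t _ => hg.lipschitzOnWith
        continuousOn := fun x _ => continuousOn_const
        norm_le := fun t _ x _ => hL x
        mul_max_le := by simp }
    exact hpl.exists_eq_forall_mem_Icc_hasDerivWithinAt₀
  choose X hX0 hX using key
  have hXd : ∀ n : ℕ, ∀ t ∈ Ioo (-(n+1 : ℝ)) (n+1), HasDerivAt (X n) (g (X n t)) t := by
    intro n t ht
    exact (hX n t ⟨ht.1.le, ht.2.le⟩).hasDerivAt (Icc_mem_nhds ht.1 ht.2)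
  have huniq : ∀ m n : ℕ, m ≤ n → EqOn (X m) (X n) (Ioo (-(m+1 : ℝ)) (m+1)) := by
    intro m n hmn
    have hmn' : (m:ℝ) ≤ n := by exact_mod_cast hmn
    have hm : (0:ℝ) ≤ m := Nat.cast_nonneg m
    apply ODE_solution_unique_of_mem_Ioo (v := fun _ => g) (K := k) (s := fun _ => univ) (t₀ := 0)
    · exact fun t _ => hg.lipschitzOnWith
    · constructor <;> linarith
    · exact fun t ht => ⟨hXd m t ht, trivial⟩
    · exact fun t ht => ⟨hXd n t ⟨by linarith [ht.1], by linarith [ht.2]⟩, trivial⟩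
    · rw [hX0, hX0]
  refine ⟨fun t => X (⌈|t|⌉₊) t, by simp [hX0], ?_⟩
  intro t
  set N := ⌈|t|⌉₊ + 1 with hN
  have hle : |t| ≤ ⌈|t|⌉₊ := Nat.le_ceil _
  have hIoo : Ioo (-(⌈|t|⌉₊ + 1 : ℝ)) (⌈|t|⌉₊ + 1) ∈ 𝓝 t := by
    have := abs_le.1 hle
    apply Ioo_mem_nhds <;> linarith
  have hev : (fun t => X (⌈|t|⌉₊) t) =ᶠ[𝓝 t] X N := by
    filter_upwards [hIoo] with s hs
    have hs' : |s| ≤ (N : ℝ) := by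
      rw [abs_le, hN]; push_cast; constructor <;> linarith [hs.1, hs.2]
    have h1 : ⌈|s|⌉₊ ≤ N := Nat.ceil_le.2 hs'
    apply huniq _ _ h1
    have := abs_le.1 (Nat.le_ceil |s|)
    constructor <;> linarith
  have := (hXd N t (by
    have := abs_le.1 hle
    rw [hN]; push_cast
    constructor <;> linarith)).congr_of_eventuallyEq hev
  rwa [← hev.eq_of_nhds] at this

def clampB (lo hi x : Fin 4 → ℝ) : Fin 4 → ℝ := fun i => max (lo i) (min (x i) (hi i))

lemma clampB_lip (lo hi : Fin 4 → ℝ) : LipschitzWith 1 (clampB lo hi) := by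
  apply LipschitzWith.of_dist_le_mul
  intro x y
  have hd : 0 ≤ ((1 : NNReal) : ℝ) * dist x y := by positivity
  rw [dist_pi_le_iff hd]
  intro i
  have h := (LipschitzWith.eval (α := fun _ : Fin 4 => ℝ) i)
  exact ((h.min_const (hi i)).const_max (lo i)).dist_le_mul x y

lemma clampB_mem {lo hi : Fin 4 → ℝ} (h : lo ≤ hi) (x : Fin 4 → ℝ) : clampB lo hi x ∈ Icc lo hi := by
  constructor
  · intro i; exact le_max_left _ _
  · intro i; exact max_le (h i) (min_le_right _ _)

lemma clampB_eq {lo hi x : Fin 4 → ℝ} (h : x ∈ Icc lo hi) : clampB lo hi x = x := by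
  funext i
  simp only [clampB]
  rw [min_eq_left (h.2 i), max_eq_right (h.1 i)]

/-- general existence in an invariant box -/
lemma box_exists (f : (Fin 4 → ℝ) → (Fin 4 → ℝ)) (lo hi : Fin 4 → ℝ) (hlh : lo ≤ hi)
    (hf : ∃ k, LipschitzOnWith k f (Icc lo hi))
    (hlo : ∀ x ∈ Icc lo hi, ∀ i, x i = lo i → 0 ≤ f x i)
    (hhi : ∀ x ∈ Icc lo hi, ∀ i, x i = hi i → f x i ≤ 0)
    (x₀ : Fin 4 → ℝ) (hx₀ : x₀ ∈ Icc lo hi) :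
    ∃ x : ℝ → Fin 4 → ℝ, x 0 = x₀ ∧ (∀ t, 0 ≤ t → HasDerivAt x (f (x t)) t) ∧
      ∀ t, 0 ≤ t → x t ∈ Icc lo hi := by
  obtain ⟨k, hk⟩ := hf
  have hglip : LipschitzWith (k * 1) (f ∘ clampB lo hi) := by
    rw [← lipschitzOnWith_univ]
    exact hk.comp ((clampB_lip lo hi).lipschitzOnWith) (fun x _ => clampB_mem hlh x)
  obtain ⟨B, hB⟩ := (isCompact_Icc (a := lo) (b := hi)).exists_bound_of_continuousOn hk.continuousOn
  have hB' : ∀ x, ‖(f ∘ clampB lo hi) x‖ ≤ (B.toNNReal : NNReal) := fun x =>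
    (hB _ (clampB_mem hlh x)).trans (Real.le_coe_toNNReal B)
  obtain ⟨x, hx0, hx⟩ := global_exists _ _ _ hglip hB' x₀
  have hxi : ∀ t i, HasDerivAt (fun t => x t i) (f (clampB lo hi (x t)) i) t := by
    intro t i
    exact (hasDerivAt_pi.1 (hx t)) i
  have hmem : ∀ t, 0 ≤ t → x t ∈ Icc lo hi := by
    intro t ht
    constructor
    · intro i
      refine barrier_ge (T := 0) (C := lo i) (fun t _ => hxi t i) (by rw [hx0]; exact hx₀.1 i) ?_ t ht
      intro t _ hlt
      apply hlo _ (clampB_mem hlh _)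
      simp only [clampB]
      exact max_eq_left ((min_le_left _ _).trans hlt.le)
    · intro i
      refine barrier (T := 0) (C := hi i) (fun t _ => hxi t i) (by rw [hx0]; exact hx₀.2 i) ?_ t ht
      intro t _ hlt
      apply hhi _ (clampB_mem hlh _)
      simp only [clampB]
      rw [min_eq_right hlt.le]
      exact max_eq_right (hlh i)
  refine ⟨x, hx0, fun t ht => ?_, hmem⟩
  have := hx t
  rwa [Function.comp, clampB_eq (hmem t ht)] at this

/-- uniqueness in the orthant -/
lemma orthant_unique (f : (Fin 4 → ℝ) → (Fin 4 → ℝ))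
    (hf : ∀ hi : Fin 4 → ℝ, ∃ k, LipschitzOnWith k f (Icc 0 hi))
    (x y : ℝ → Fin 4 → ℝ) (hx : IsSolOn f Orthant x) (hy : IsSolOn f Orthant y)
    (h0 : x 0 = y 0) : ∀ t, 0 ≤ t → x t = y t := by
  intro T hT
  have hcx : ContinuousOn x (Icc 0 T) := fun t ht => (hx.1 t ht.1).continuousAt.continuousWithinAt
  have hcy : ContinuousOn y (Icc 0 T) := fun t ht => (hy.1 t ht.1).continuousAt.continuousWithinAt
  obtain ⟨A, hA⟩ := isCompact_Icc.exists_bound_of_continuousOn hcx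
  obtain ⟨B, hB⟩ := isCompact_Icc.exists_bound_of_continuousOn hcy
  obtain ⟨k, hk⟩ := hf (fun _ => max A B)
  refine ODE_solution_unique_of_mem_Icc_right (v := fun _ => f) (K := k)
    (s := fun _ => Icc 0 (fun _ => max A B)) (a := 0) (b := T) (fun _ _ => hk) hcx
    (fun t ht => (hx.1 t ht.1).hasDerivWithinAt) ?_ hcy
    (fun t ht => (hy.1 t ht.1).hasDerivWithinAt) ?_ h0 ⟨hT, le_refl _⟩
  · intro t ht
    refine ⟨fun i => hx.2 t ht.1 i, fun i => ?_⟩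
    exact (le_abs_self _).trans ((norm_le_pi_norm (x t) i).trans
      ((hA t ⟨ht.1, ht.2.le⟩).trans (le_max_left _ _)))
  · intro t ht
    refine ⟨fun i => hy.2 t ht.1 i, fun i => ?_⟩
    exact (le_abs_self _).trans ((norm_le_pi_norm (y t) i).trans
      ((hB t ⟨ht.1, ht.2.le⟩).trans (le_max_right _ _)))

lemma box_invariant (f : (Fin 4 → ℝ) → (Fin 4 → ℝ)) (lo hi : Fin 4 → ℝ) (hlh : lo ≤ hi)
    (hl0 : 0 ≤ lo)
    (hf : ∀ hi : Fin 4 → ℝ, ∃ k, LipschitzOnWith k f (Icc 0 hi))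
    (hlo : ∀ x ∈ Icc lo hi, ∀ i, x i = lo i → 0 ≤ f x i)
    (hhi : ∀ x ∈ Icc lo hi, ∀ i, x i = hi i → f x i ≤ 0)
    (x : ℝ → Fin 4 → ℝ) (hx : IsSolOn f Orthant x) (hx₀ : x 0 ∈ Icc lo hi) :
    ∀ t, 0 ≤ t → x t ∈ Icc lo hi := by
  obtain ⟨k, hk⟩ := hf hi
  obtain ⟨y, hy0, hy, hym⟩ := box_exists f lo hi hlh ⟨k, hk.mono (Icc_subset_Icc_left hl0)⟩
    hlo hhi (x 0) hx₀
  intro t ht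
  rw [orthant_unique f hf x y hx ⟨hy, fun t ht i => (hl0 i).trans ((hym t ht).1 i)⟩ hy0.symm t ht]
  exact hym t ht

/-- eventual upper bound predicate -/
def EvUB (u : ℝ → ℝ) (A : ℝ) : Prop := ∀ ε > 0, ∀ᶠ t in atTop, u t < A + ε

lemma EvUB.relax {u g h : ℝ → ℝ} {c G : ℝ} (hc : 0 < c)
    (hu : ∀ t, 0 ≤ t → HasDerivAt u (h t * (g t - u t)) t)
    (hh : ∀ t, 0 ≤ t → c ≤ h t) (hg : EvUB g G) : EvUB u G := by
  intro ε hε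
  obtain ⟨T0, hT0⟩ := eventually_atTop.1 (hg (ε/2) (by linarith))
  set T := max T0 0
  have hT : ∀ t, T ≤ t → g t < G + ε/2 := fun t ht => hT0 t ((le_max_left _ _).trans ht)
  have hTp : ∀ t, T ≤ t → 0 ≤ t := fun t ht => (le_max_right _ _).trans ht
  set W : ℝ → ℝ := fun t => (u t - (G + ε/2)) * Real.exp (c * t) with hW
  have hWd : ∀ t, T ≤ t → HasDerivAt W (h t * (g t - u t) * Real.exp (c * t) +
      (u t - (G + ε/2)) * (Real.exp (c * t) * (c * 1))) t := by
    intro t ht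
    exact ((hu t (hTp t ht)).sub_const _).mul (((hasDerivAt_id t).const_mul c).exp)
  have hb := barrier (C := max (W T) 0) hWd (le_max_left _ _) (by
    intro t ht hlt
    have hpos : 0 < W t := (le_max_right _ _).trans_lt hlt
    have he := Real.exp_pos (c * t)
    have hw : 0 < u t - (G + ε/2) := by
      by_contra hn
      push Not at hn
      have : W t ≤ 0 := mul_nonpos_of_nonpos_of_nonneg hn he.le
      linarith
    have h1 := hT t ht
    have h2 := hh t (hTp t ht)
    have : h t * (g t - u t) + (u t - (G + ε/2)) * c ≤ 0 := by nlinarith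
    nlinarith)
  have hlim : Tendsto (fun t => max (W T) 0 * Real.exp (-(c * t))) atTop (𝓝 0) := by
    have : Tendsto (fun t : ℝ => Real.exp (-(c * t))) atTop (𝓝 0) :=
      Real.tendsto_exp_neg_atTop_nhds_zero.comp (tendsto_id.const_mul_atTop hc)
    simpa using this.const_mul (max (W T) 0)
  filter_upwards [hlim.eventually (gt_mem_nhds (show (0:ℝ) < ε/2 by linarith)),
    eventually_ge_atTop T] with t ht1 ht2
  have h1 := hb t ht2
  have he := Real.exp_pos (c * t)
  rw [Real.exp_neg] at ht1
  have : u t - (G + ε/2) ≤ max (W T) 0 * (Real.exp (c*t))⁻¹ := by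
    rw [← div_eq_mul_inv, le_div_iff₀ he]; exact h1
  linarith

lemma EvUB.relax_neg {u g h : ℝ → ℝ} {c G : ℝ} (hc : 0 < c)
    (hu : ∀ t, 0 ≤ t → HasDerivAt u (h t * (g t - u t)) t)
    (hh : ∀ t, 0 ≤ t → c ≤ h t) (hg : EvUB (fun t => - g t) G) : EvUB (fun t => - u t) G := by
  apply EvUB.relax hc (h := h) (g := fun t => - g t) _ hh hg
  intro t ht
  exact (hu t ht).neg.congr_deriv (by ring)

lemma EvUB.comp {F : ℝ → ℝ} {A : ℝ} {s : Set ℝ} {φ : ℝ → ℝ} (hF : EvUB F A)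
    (hs : s ∈ 𝓝 A) (hm : MonotoneOn φ s) (hc : ContinuousAt φ A) (hFs : ∀ t, 0 ≤ t → F t ∈ s) :
    EvUB (fun t => φ (F t)) (φ A) := by
  intro ε hε
  have h1 : ∀ᶠ z in 𝓝 A, φ z < φ A + ε ∧ z ∈ s :=
    (hc.eventually (gt_mem_nhds (show φ A < φ A + ε by linarith))).and hs
  obtain ⟨d, hd, hball⟩ := Metric.eventually_nhds_iff.1 h1
  have h2 := hball (y := A + d/2) (by
    rw [Real.dist_eq, show A + d/2 - A = d/2 by ring, abs_of_pos (by linarith)]; linarith)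
  filter_upwards [hF (d/2) (by linarith), eventually_ge_atTop 0] with t ht ht0
  exact (hm (hFs t ht0) h2.2 ht.le).trans_lt h2.1

lemma EvUB.lin {u v : ℝ → ℝ} {A B p q : ℝ} (hu : EvUB u A) (hv : EvUB v B) (hp : 0 < p)
    (hq : 0 < q) : EvUB (fun t => p * u t + q * v t) (p * A + q * B) := by
  intro ε hε
  filter_upwards [hu (ε/(2*p)) (by positivity), hv (ε/(2*q)) (by positivity)] with t h1 h2
  have h3 := mul_lt_mul_of_pos_left h1 hp
  have h4 := mul_lt_mul_of_pos_left h2 hq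
  have e1 : p * (A + ε/(2*p)) = p * A + ε/2 := by field_simp
  have e2 : q * (B + ε/(2*q)) = q * B + ε/2 := by field_simp
  linarith

lemma EvUB.smul {u : ℝ → ℝ} {A p : ℝ} (hu : EvUB u A) (hp : 0 < p) :
    EvUB (fun t => p * u t) (p * A) := by
  intro ε hε
  filter_upwards [hu (ε/p) (by positivity)] with t h1
  have h3 := mul_lt_mul_of_pos_left h1 hp
  have e1 : p * (A + ε/p) = p * A + ε := by field_simp
  linarith

lemma EvUB.mono {u : ℝ → ℝ} {A B : ℝ} (hu : EvUB u A) (h : A ≤ B) : EvUB u B := by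
  intro ε hε
  filter_upwards [hu ε hε] with t ht
  linarith

lemma EvUB.exists_least {u : ℝ → ℝ} {l m : ℝ} (hl : ∀ t, 1 ≤ t → l ≤ u t)
    (hm : ∀ t, 1 ≤ t → u t ≤ m) :
    ∃ A, l ≤ A ∧ EvUB u A ∧ ∀ B, EvUB u B → A ≤ B := by
  set S := {B | EvUB u B} with hS
  have hne : S.Nonempty := ⟨m, fun ε hε => by
    filter_upwards [eventually_ge_atTop 1] with t ht
    linarith [hm t ht]⟩
  have hlb : ∀ B ∈ S, l ≤ B := by
    intro B hB
    apply le_of_forall_pos_lt_add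
    intro ε hε
    obtain ⟨t, h1, h2⟩ := ((hB ε hε).and (eventually_ge_atTop 1)).exists
    exact (hl t h2).trans_lt h1
  have hbdd : BddBelow S := ⟨l, hlb⟩
  refine ⟨sInf S, le_csInf hne hlb, ?_, fun B hB => csInf_le hbdd hB⟩
  intro ε hε
  obtain ⟨B, hB, hlt⟩ := exists_lt_of_csInf_lt hne (show sInf S < sInf S + ε/2 by linarith)
  filter_upwards [hB (ε/2) (by linarith)] with t ht
  linarith

lemma EvUB.tendsto {u : ℝ → ℝ} {A : ℝ} (h1 : EvUB u A) (h2 : EvUB (fun t => - u t) (-A)) :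
    Tendsto u atTop (𝓝 A) := by
  rw [Metric.tendsto_nhds]
  intro ε hε
  filter_upwards [h1 ε hε, h2 ε hε] with t a b
  rw [Real.dist_eq, abs_lt]
  constructor <;> linarith

lemma EvUB.of_tendsto {u : ℝ → ℝ} {A : ℝ} (h : Tendsto u atTop (𝓝 A)) : EvUB u A :=
  fun ε hε => h.eventually (gt_mem_nhds (show A < A + ε by linarith))

lemma relax_tendsto {u g h : ℝ → ℝ} {c G : ℝ} (hc : 0 < c)
    (hu : ∀ t, 0 ≤ t → HasDerivAt u (h t * (g t - u t)) t)
    (hh : ∀ t, 0 ≤ t → c ≤ h t) (hg : Tendsto g atTop (𝓝 G)) : Tendsto u atTop (𝓝 G) :=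
  EvUB.tendsto (EvUB.relax hc hu hh (EvUB.of_tendsto hg))
    (EvUB.relax_neg hc hu hh (EvUB.of_tendsto hg.neg))

lemma pos_persist {u u' : ℝ → ℝ} {L T : ℝ} (hu : ∀ t, T ≤ t → HasDerivAt u (u' t) t)
    (h : ∀ t, T ≤ t → - (L * u t) ≤ u' t) (h0 : 0 < u T) : ∀ t, T ≤ t → 0 < u t := by
  intro t ht
  have := barrier_ge (u := fun t => u t * Real.exp (L * t)) (T := T) (C := u T * Real.exp (L * T))
    (fun t ht => (hu t ht).mul (((hasDerivAt_id t).const_mul L).exp)) le_rfl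
    (by
      intro t ht _
      have he := Real.exp_pos (L * t)
      have := h t ht
      simp only [id]
      nlinarith) t ht
  have h1 := Real.exp_pos (L * T)
  have h2 := Real.exp_pos (L * t)
  by_contra hn
  push Not at hn
  nlinarith [mul_pos h0 h1]

lemma pos_gen {u u' : ℝ → ℝ} {L T : ℝ} (hu : ∀ t, T ≤ t → HasDerivAt u (u' t) t)
    (h : ∀ t, T ≤ t → - (L * u t) < u' t) (h0 : 0 ≤ u T) : ∀ t, T < t → 0 < u t := by
  intro t ht
  have hmono : StrictMonoOn (fun t => u t * Real.exp (L * t)) (Ici T) := by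
    have hd : ∀ t, T ≤ t → HasDerivAt (fun t => u t * Real.exp (L * t)) _ t :=
      fun t ht => (hu t ht).mul (((hasDerivAt_id t).const_mul L).exp)
    apply strictMonoOn_of_deriv_pos (convex_Ici T)
    · exact fun t ht => (hd t ht).continuousAt.continuousWithinAt
    · intro t ht
      rw [interior_Ici] at ht
      rw [(hd t (le_of_lt ht)).deriv]
      have he := Real.exp_pos (L * t)
      have := h t (le_of_lt ht)
      simp only [id]
      nlinarith
  have h3 := hmono (mem_Ici.2 le_rfl) (mem_Ici.2 ht.le) ht
  simp only at h3
  have h1 := Real.exp_pos (L * T)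
  have h2 := Real.exp_pos (L * t)
  by_contra hn
  push Not at hn
  nlinarith [mul_nonneg h0 h1.le]

lemma cab_lip (b K r νI μI νY μY δ μF μM α YP : ℝ) (hYP : 0 < YP) (hi : Fin 4 → ℝ) :
    ∃ k, LipschitzOnWith k (cAbund b K r νI μI νY μY δ μF μM α YP) (Icc 0 hi) := by
  apply LocallyLipschitzOn.exists_lipschitzOnWith_of_compact isCompact_Icc
  intro x hx
  have h1 : 0 ≤ x 1 := hx.1 1
  have hne : x 1 + YP ≠ 0 := by positivity
  have hcd : ContDiffAt ℝ 1 (cAbund b K r νI μI νY μY δ μF μM α YP) x := by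
    rw [contDiffAt_pi]
    intro i
    fin_cases i
    · simp only [cAbund]; simp; fun_prop
    · simp only [cAbund]; simp; fun_prop
    · simp only [cAbund]; simp; fun_prop
    · simp only [cAbund]; simp; fun_prop (disch := assumption)
  obtain ⟨k, t, ht, hk⟩ := hcd.exists_lipschitzOnWith
  exact ⟨k, t, mem_nhdsWithin_of_mem_nhds ht, hk⟩

lemma cab_lo (b K r νI μI νY μY δ μF μM α YP : ℝ)
    (hb : 0 < b) (hr : 0 < r) (hr1 : r < 1)
    (hνI : 0 < νI) (hμI : 0 < μI) (hνY : 0 < νY)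
    (hδ : 0 < δ) (hα : 0 ≤ α) (hYP : 0 < YP)
    (lo hi : Fin 4 → ℝ) (h0 : 0 ≤ lo)
    (L0 : (νI + μI) * lo 0 ≤ b * (1 - lo 0 / K) * lo 2)
    (L1 : (νY + μY) * lo 1 ≤ r * νI * lo 0 + δ * lo 2)
    (L2 : (δ + μF) * lo 2 ≤ νY * lo 1)
    (L3 : (μM + α * YP / (lo 1 + YP)) * lo 3 ≤ (1 - r) * νI * lo 0) :
    ∀ x ∈ Icc lo hi, ∀ i, x i = lo i → 0 ≤ cAbund b K r νI μI νY μY δ μF μM α YP x i := by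
  intro x hx i hi
  have z0 : 0 ≤ lo 0 := h0 0
  have z1 : 0 ≤ lo 1 := h0 1
  have z2 : 0 ≤ lo 2 := h0 2
  have z3 : 0 ≤ lo 3 := h0 3
  have x0 := hx.1 0
  have x1 := hx.1 1
  have x2 := hx.1 2
  have x3 := hx.1 3
  fin_cases i
  · simp [cAbund] at hi ⊢
    rw [hi]
    rcases le_total 0 (1 - lo 0 / K) with h | h
    · have : b * (1 - lo 0 / K) * lo 2 ≤ b * (1 - lo 0 / K) * x 2 :=
        mul_le_mul_of_nonneg_left x2 (by positivity)
      linarith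
    · exfalso
      have h1 : b * (1 - lo 0 / K) * lo 2 ≤ 0 :=
        mul_nonpos_of_nonpos_of_nonneg (mul_nonpos_of_nonneg_of_nonpos hb.le h) z2
      have h2 : 0 < lo 0 := by
        rcases z0.lt_or_eq with h3 | h3
        · exact h3
        · rw [← h3] at h; norm_num at h
      nlinarith [mul_pos (add_pos hνI hμI) h2]
  · simp [cAbund] at hi ⊢
    rw [hi]
    have := mul_le_mul_of_nonneg_left x0 (mul_pos hr hνI).le
    have := mul_le_mul_of_nonneg_left x2 hδ.le
    linarith
  · simp [cAbund] at hi ⊢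
    rw [hi]
    have := mul_le_mul_of_nonneg_left x1 hνY.le
    linarith
  · simp [cAbund] at hi ⊢
    rw [hi]
    have h1 := mul_le_mul_of_nonneg_left x0 (mul_pos (sub_pos.2 hr1) hνI).le
    have h2 : α * YP / (x 1 + YP) ≤ α * YP / (lo 1 + YP) := by gcongr
    have h3 := mul_le_mul_of_nonneg_right h2 z3
    linarith

lemma cab_hi (b K r νI μI νY μY δ μF μM α YP : ℝ)
    (hb : 0 < b) (hr : 0 < r) (hr1 : r < 1)
    (hνI : 0 < νI) (hμI : 0 < μI) (hνY : 0 < νY)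
    (hδ : 0 < δ) (hα : 0 ≤ α) (hYP : 0 < YP)
    (lo hi : Fin 4 → ℝ) (h0 : 0 ≤ lo)
    (L0 : b * (1 - hi 0 / K) * hi 2 ≤ (νI + μI) * hi 0)
    (L1 : r * νI * hi 0 + δ * hi 2 ≤ (νY + μY) * hi 1)
    (L2 : νY * hi 1 ≤ (δ + μF) * hi 2)
    (L3 : (1 - r) * νI * hi 0 ≤ (μM + α * YP / (hi 1 + YP)) * hi 3) :
    ∀ x ∈ Icc lo hi, ∀ i, x i = hi i → cAbund b K r νI μI νY μY δ μF μM α YP x i ≤ 0 := by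
  intro x hx i hi'
  have y0 : 0 ≤ x 0 := (h0 0).trans (hx.1 0)
  have y1 : 0 ≤ x 1 := (h0 1).trans (hx.1 1)
  have y2 : 0 ≤ x 2 := (h0 2).trans (hx.1 2)
  have y3 : 0 ≤ x 3 := (h0 3).trans (hx.1 3)
  have x0 := hx.2 0
  have x1 := hx.2 1
  have x2 := hx.2 2
  have x3 := hx.2 3
  have z3 : 0 ≤ hi 3 := y3.trans x3
  fin_cases i
  · simp [cAbund] at hi' ⊢
    rw [hi']
    rcases le_total 0 (1 - hi 0 / K) with h | h
    · have : b * (1 - hi 0 / K) * x 2 ≤ b * (1 - hi 0 / K) * hi 2 :=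
        mul_le_mul_of_nonneg_left x2 (by positivity)
      linarith
    · have h1 : b * (1 - hi 0 / K) * x 2 ≤ 0 :=
        mul_nonpos_of_nonpos_of_nonneg (mul_nonpos_of_nonneg_of_nonpos hb.le h) y2
      nlinarith [mul_nonneg (add_pos hνI hμI).le (y0.trans x0)]
  · simp [cAbund] at hi' ⊢
    rw [hi']
    have := mul_le_mul_of_nonneg_left x0 (mul_pos hr hνI).le
    have := mul_le_mul_of_nonneg_left x2 hδ.le
    linarith
  · simp [cAbund] at hi' ⊢
    rw [hi']
    have := mul_le_mul_of_nonneg_left x1 hνY.le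
    linarith
  · simp [cAbund] at hi' ⊢
    rw [hi']
    have h1 := mul_le_mul_of_nonneg_left x0 (mul_pos (sub_pos.2 hr1) hνI).le
    have h2 : α * YP / (hi 1 + YP) ≤ α * YP / (x 1 + YP) := by gcongr
    have h3 := mul_le_mul_of_nonneg_right h2 z3
    linarith

lemma cab_big (b K r νI μI νY μY δ μF μM α YP : ℝ)
    (hb : 0 < b) (hK : 0 < K) (hr : 0 < r) (hr1 : r < 1)
    (hνI : 0 < νI) (hμI : 0 < μI) (hνY : 0 < νY) (hμY : 0 < μY)
    (hδ : 0 < δ) (hμF : 0 < μF) (hμM : 0 < μM) (hα : 0 ≤ α) (hYP : 0 < YP)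
    (x₀ : Fin 4 → ℝ) :
    ∃ hi : Fin 4 → ℝ, 0 ≤ hi ∧ x₀ ≤ hi ∧
    b * (1 - hi 0 / K) * hi 2 ≤ (νI + μI) * hi 0 ∧
    r * νI * hi 0 + δ * hi 2 ≤ (νY + μY) * hi 1 ∧
    νY * hi 1 ≤ (δ + μF) * hi 2 ∧
    (1 - r) * νI * hi 0 ≤ (μM + α * YP / (hi 1 + YP)) * hi 3 := by
  have hD : 0 < (νY + μY) * (δ + μF) - δ * νY := by nlinarith [mul_pos hνY hμF, mul_pos hμY hδ, mul_pos hμY hμF]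
  set D := (νY + μY) * (δ + μF) - δ * νY with hDd
  obtain ⟨k1, hk1, hk1e⟩ : ∃ k1, 0 < k1 ∧ k1 = r * νI * (δ + μF) / D := ⟨_, by positivity, rfl⟩
  obtain ⟨k2, hk2, hk2e⟩ : ∃ k2, 0 < k2 ∧ k2 = r * νI * νY / D := ⟨_, by positivity, rfl⟩
  set A := max (max K (x₀ 0)) (max (x₀ 1 / k1) (x₀ 2 / k2)) with hA
  have a0 : K ≤ A := (le_max_left _ _).trans (le_max_left _ _)
  have a1 : x₀ 0 ≤ A := (le_max_right _ _).trans (le_max_left _ _)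
  have a2 : x₀ 1 / k1 ≤ A := (le_max_left _ _).trans (le_max_right _ _)
  have a3 : x₀ 2 / k2 ≤ A := (le_max_right _ _).trans (le_max_right _ _)
  have hAp : 0 < A := hK.trans_le a0
  rw [div_le_iff₀ hk1] at a2
  rw [div_le_iff₀ hk2] at a3
  have hr' : 0 < 1 - r := sub_pos.2 hr1
  have hM : 0 ≤ (1 - r) * νI * A / μM := by positivity
  refine ⟨![A, A * k1, A * k2, max (x₀ 3) ((1 - r) * νI * A / μM)], ?_, ?_, ?_, ?_, ?_, ?_⟩
  · intro i
    fin_cases i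
    · exact hAp.le
    · exact (mul_pos hAp hk1).le
    · exact (mul_pos hAp hk2).le
    · exact hM.trans (le_max_right _ _)
  · intro i
    fin_cases i
    · exact a1
    · exact a2
    · exact a3
    · exact le_max_left _ _
  · simp
    have : 1 - A / K ≤ 0 := by rw [sub_nonpos, le_div_iff₀ hK]; linarith
    have h1 : b * (1 - A / K) * (A * k2) ≤ 0 :=
        mul_nonpos_of_nonpos_of_nonneg (mul_nonpos_of_nonneg_of_nonpos hb.le this) (by positivity)
    have : 0 ≤ (νI + μI) * A := by positivity
    linarith
  · simp
    have : (νY + μY) * k1 - δ * k2 = r * νI := by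
      rw [hk1e, hk2e]; field_simp; rw [hDd]; ring
    have : ((νY + μY) * k1 - δ * k2) * A = r * νI * A := by rw [this]
    linarith
  · simp
    apply le_of_eq
    rw [hk1e, hk2e]; field_simp
  · simp
    have h1 : (1 - r) * νI * A = μM * ((1 - r) * νI * A / μM) := by field_simp
    have h2 := le_max_right (x₀ 3) ((1 - r) * νI * A / μM)
    have h3 : 0 ≤ α * YP / (A * k1 + YP) := by positivity
    set M := max (x₀ 3) ((1 - r) * νI * A / μM)
    have hMp : 0 ≤ M := hM.trans h2
    have := mul_le_mul_of_nonneg_left h2 hμM.le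
    have := mul_nonneg h3 hMp
    linarith

lemma cab_lo_zero (b K r νI μI νY μY δ μF μM α YP : ℝ)
    (hb : 0 < b) (hr : 0 < r) (hr1 : r < 1)
    (hνI : 0 < νI) (hμI : 0 < μI) (hνY : 0 < νY)
    (hδ : 0 < δ) (hα : 0 ≤ α) (hYP : 0 < YP) (hi : Fin 4 → ℝ) :
    ∀ x ∈ Icc 0 hi, ∀ i, x i = (0 : Fin 4 → ℝ) i →
      0 ≤ cAbund b K r νI μI νY μY δ μF μM α YP x i := by
  apply cab_lo <;> first | assumption | simp

lemma cab_posdyn (b K r νI μI νY μY δ μF μM α YP : ℝ)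
    (hb : 0 < b) (hK : 0 < K) (hr : 0 < r) (hr1 : r < 1)
    (hνI : 0 < νI) (hμI : 0 < μI) (hνY : 0 < νY) (hμY : 0 < μY)
    (hδ : 0 < δ) (hμF : 0 < μF) (hμM : 0 < μM) (hα : 0 ≤ α) (hYP : 0 < YP) :
    PositiveDynSys (cAbund b K r νI μI νY μY δ μF μM α YP) Orthant := by
  intro x₀ hx₀
  obtain ⟨hi, h0, hx, U0, U1, U2, U3⟩ := cab_big b K r νI μI νY μY δ μF μM α YP hb hK hr hr1
    hνI hμI hνY hμY hδ hμF hμM hα hYP x₀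
  obtain ⟨x, hx0, hxd, hxm⟩ := box_exists (cAbund b K r νI μI νY μY δ μF μM α YP) 0 hi h0
    (cab_lip b K r νI μI νY μY δ μF μM α YP hYP hi)
    (cab_lo_zero b K r νI μI νY μY δ μF μM α YP hb hr hr1 hνI hμI hνY hδ hα hYP hi)
    (cab_hi b K r νI μI νY μY δ μF μM α YP hb hr hr1 hνI hμI hνY hδ hα hYP 0 hi le_rfl U0 U1 U2 U3)
    x₀ ⟨hx₀, hx⟩
  have hsol : IsSolOn (cAbund b K r νI μI νY μY δ μF μM α YP) Orthant x :=
    ⟨hxd, fun t ht i => (hxm t ht).1 i⟩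
  refine ⟨x, hx0, hsol, fun y hy0 hy => ?_⟩
  exact orthant_unique _ (cab_lip b K r νI μI νY μY δ μF μM α YP hYP) y x hy hsol
    (by rw [hx0, hy0])

lemma phi_mono {b K c : ℝ} (hb : 0 < b) (hK : 0 < K) (hc : 0 < c) :
    MonotoneOn (fun z => b * z / (b * z / K + c)) (Ioi (-(c * K / b))) := by
  have key : ∀ z, z ∈ Ioi (-(c * K / b)) → 0 < b * z / K + c := by
    intro z hz
    have hz : -(c * K / b) < z := hz
    have : b / K * (-(c * K / b)) < b / K * z := mul_lt_mul_of_pos_left hz (by positivity)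
    have e : b / K * (-(c * K / b)) = -c := by field_simp
    have e2 : b / K * z = b * z / K := by ring
    linarith
  intro z1 h1 z2 h2 h
  have k1 := key z1 h1
  have k2 := key z2 h2
  simp only
  rw [div_le_div_iff₀ k1 k2]
  have : b * z1 * (b * z2 / K) = b * z2 * (b * z1 / K) := by ring
  have : b * c * z1 ≤ b * c * z2 := mul_le_mul_of_nonneg_left h (by positivity)
  nlinarith

lemma phi_mono_neg {b K c : ℝ} (hb : 0 < b) (hK : 0 < K) (hc : 0 < c) :
    MonotoneOn (fun z => -(b * (-z) / (b * (-z) / K + c))) (Iio (c * K / b)) := by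
  intro z1 h1 z2 h2 h
  have h1 : z1 < c * K / b := h1
  have h2 : z2 < c * K / b := h2
  have m1 : -z1 ∈ Ioi (-(c * K / b)) := by rw [mem_Ioi]; linarith
  have m2 : -z2 ∈ Ioi (-(c * K / b)) := by rw [mem_Ioi]; linarith
  have := phi_mono hb hK hc m2 m1 (by linarith)
  simp only at this ⊢
  linarith

lemma cab_comp (b K r νI μI νY μY δ μF μM α YP : ℝ) (S : Set (Fin 4 → ℝ)) (x : ℝ → Fin 4 → ℝ)
    (hx : IsSolOn (cAbund b K r νI μI νY μY δ μF μM α YP) S x) :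
    (∀ t, 0 ≤ t → HasDerivAt (fun t => x t 0)
      (b * (1 - x t 0 / K) * x t 2 - (νI + μI) * x t 0) t) ∧
    (∀ t, 0 ≤ t → HasDerivAt (fun t => x t 1)
      (r * νI * x t 0 - (νY + μY) * x t 1 + δ * x t 2) t) ∧
    (∀ t, 0 ≤ t → HasDerivAt (fun t => x t 2) (νY * x t 1 - (δ + μF) * x t 2) t) ∧
    (∀ t, 0 ≤ t → HasDerivAt (fun t => x t 3)
      ((1 - r) * νI * x t 0 - (μM + α * YP / (x t 1 + YP)) * x t 3) t) :=
  ⟨fun t ht => (hasDerivAt_pi.1 (hx.1 t ht)) 0, fun t ht => (hasDerivAt_pi.1 (hx.1 t ht)) 1,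
   fun t ht => (hasDerivAt_pi.1 (hx.1 t ht)) 2, fun t ht => (hasDerivAt_pi.1 (hx.1 t ht)) 3⟩

lemma cab_bdd (b K r νI μI νY μY δ μF μM α YP : ℝ)
    (hb : 0 < b) (hK : 0 < K) (hr : 0 < r) (hr1 : r < 1)
    (hνI : 0 < νI) (hμI : 0 < μI) (hνY : 0 < νY) (hμY : 0 < μY)
    (hδ : 0 < δ) (hμF : 0 < μF) (hμM : 0 < μM) (hα : 0 ≤ α) (hYP : 0 < YP)
    (x : ℝ → Fin 4 → ℝ)
    (hx : IsSolOn (cAbund b K r νI μI νY μY δ μF μM α YP) Orthant x) :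
    ∃ hi : Fin 4 → ℝ, ∀ t, 0 ≤ t → x t ≤ hi := by
  obtain ⟨hi, h0, hxh, U0, U1, U2, U3⟩ := cab_big b K r νI μI νY μY δ μF μM α YP hb hK hr hr1
    hνI hμI hνY hμY hδ hμF hμM hα hYP (x 0)
  refine ⟨hi, fun t ht => ?_⟩
  exact (box_invariant _ 0 hi h0 le_rfl (cab_lip b K r νI μI νY μY δ μF μM α YP hYP)
    (cab_lo_zero b K r νI μI νY μY δ μF μM α YP hb hr hr1 hνI hμI hνY hδ hα hYP hi)
    (cab_hi b K r νI μI νY μY δ μF μM α YP hb hr hr1 hνI hμI hνY hδ hα hYP 0 hi le_rfl U0 U1 U2 U3)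
    x hx ⟨hx.2 0 le_rfl, hxh⟩ t ht).2

lemma cab_pos_one (b K r νI μI νY μY δ μF μM α YP : ℝ)
    (hb : 0 < b) (hK : 0 < K) (hr : 0 < r) (hr1 : r < 1)
    (hνI : 0 < νI) (hμI : 0 < μI) (hνY : 0 < νY) (hμY : 0 < μY)
    (hδ : 0 < δ) (hμF : 0 < μF) (hμM : 0 < μM) (hα : 0 ≤ α) (hYP : 0 < YP)
    (x : ℝ → Fin 4 → ℝ)
    (hx : IsSolOn (cAbund b K r νI μI νY μY δ μF μM α YP) Orthant x)
    (hx0 : ¬ (x 0 0 = 0 ∧ x 0 1 = 0 ∧ x 0 2 = 0)) :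
    0 < x 1 0 ∧ 0 < x 1 1 ∧ 0 < x 1 2 := by
  obtain ⟨hi, hhi⟩ := cab_bdd b K r νI μI νY μY δ μF μM α YP hb hK hr hr1
    hνI hμI hνY hμY hδ hμF hμM hα hYP x hx
  obtain ⟨dI, dY, dF, -⟩ := cab_comp b K r νI μI νY μY δ μF μM α YP _ x hx
  have n0 : ∀ t, 0 ≤ t → 0 ≤ x t 0 := fun t ht => hx.2 t ht 0
  have n1 : ∀ t, 0 ≤ t → 0 ≤ x t 1 := fun t ht => hx.2 t ht 1
  have n2 : ∀ t, 0 ≤ t → 0 ≤ x t 2 := fun t ht => hx.2 t ht 2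
  have hIb : ∀ t, 0 ≤ t → b * x t 2 - (b * hi 2 / K + (νI + μI)) * x t 0 ≤
      b * (1 - x t 0 / K) * x t 2 - (νI + μI) * x t 0 := by
    intro t ht
    have h1 : x t 2 ≤ hi 2 := hhi t ht 2
    have h2 : b / K * x t 0 * x t 2 ≤ b / K * x t 0 * hi 2 :=
      mul_le_mul_of_nonneg_left h1 (mul_nonneg (by positivity) (n0 t ht))
    have e1 : b * (1 - x t 0 / K) * x t 2 = b * x t 2 - b / K * x t 0 * x t 2 := by ring
    have e2 : (b * hi 2 / K + (νI + μI)) * x t 0 = b / K * x t 0 * hi 2 + (νI + μI) * x t 0 := by ring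
    linarith
  have hrI : 0 < r * νI := mul_pos hr hνI
  -- persistence
  have PI : 0 < x 0 0 → ∀ t, 0 ≤ t → 0 < x t 0 := fun h =>
    pos_persist (L := b * hi 2 / K + (νI + μI)) dI (fun t ht => by
      nlinarith [hIb t ht, mul_nonneg hb.le (n2 t ht)]) h
  have PY : 0 < x 0 1 → ∀ t, 0 ≤ t → 0 < x t 1 := fun h =>
    pos_persist (L := νY + μY) dY (fun t ht => by
      nlinarith [mul_nonneg hrI.le (n0 t ht), mul_nonneg hδ.le (n2 t ht)]) h
  have PF : 0 < x 0 2 → ∀ t, 0 ≤ t → 0 < x t 2 := fun h =>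
    pos_persist (L := δ + μF) dF (fun t ht => by
      nlinarith [mul_nonneg hνY.le (n1 t ht)]) h
  -- generation
  have GI : ∀ T, 0 ≤ T → (∀ t, T ≤ t → 0 < x t 2) → ∀ t, T < t → 0 < x t 0 := fun T hT h =>
    pos_gen (L := b * hi 2 / K + (νI + μI)) (fun t ht => dI t (hT.trans ht)) (fun t ht => by
      nlinarith [hIb t (hT.trans ht), mul_pos hb (h t ht)]) (n0 T hT)
  have GY1 : ∀ T, 0 ≤ T → (∀ t, T ≤ t → 0 < x t 0) → ∀ t, T < t → 0 < x t 1 := fun T hT h =>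
    pos_gen (L := νY + μY) (fun t ht => dY t (hT.trans ht)) (fun t ht => by
      nlinarith [mul_pos hrI (h t ht), mul_nonneg hδ.le (n2 t (hT.trans ht))]) (n1 T hT)
  have GY2 : ∀ T, 0 ≤ T → (∀ t, T ≤ t → 0 < x t 2) → ∀ t, T < t → 0 < x t 1 := fun T hT h =>
    pos_gen (L := νY + μY) (fun t ht => dY t (hT.trans ht)) (fun t ht => by
      nlinarith [mul_nonneg hrI.le (n0 t (hT.trans ht)), mul_pos hδ (h t ht)]) (n1 T hT)
  have GF : ∀ T, 0 ≤ T → (∀ t, T ≤ t → 0 < x t 1) → ∀ t, T < t → 0 < x t 2 := fun T hT h =>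
    pos_gen (L := δ + μF) (fun t ht => dF t (hT.trans ht)) (fun t ht => by
      nlinarith [mul_pos hνY (h t ht)]) (n2 T hT)
  have hhalf : (0:ℝ) ≤ 1/2 := by norm_num
  rcases (n0 0 le_rfl).lt_or_eq with h | h
  · have a := PI h
    have b := GY1 0 le_rfl a
    have c := GF (1/2) hhalf (fun t ht => b t (by linarith))
    exact ⟨a 1 (by norm_num), b 1 (by norm_num), c 1 (by norm_num)⟩
  rcases (n1 0 le_rfl).lt_or_eq with h' | h'
  · have a := PY h'
    have b := GF 0 le_rfl a
    have c := GI (1/2) hhalf (fun t ht => b t (by linarith))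
    exact ⟨c 1 (by norm_num), a 1 (by norm_num), b 1 (by norm_num)⟩
  rcases (n2 0 le_rfl).lt_or_eq with h'' | h''
  · have a := PF h''
    have b := GI 0 le_rfl a
    have c := GY2 0 le_rfl a
    exact ⟨b 1 (by norm_num), c 1 (by norm_num), a 1 (by norm_num)⟩
  exact absurd ⟨h.symm, h'.symm, h''.symm⟩ hx0

lemma cab_persist (b K r νI μI νY μY δ μF μM α YP : ℝ)
    (hb : 0 < b) (hK : 0 < K) (hr : 0 < r) (hr1 : r < 1)
    (hνI : 0 < νI) (hμI : 0 < μI) (hνY : 0 < νY) (hμY : 0 < μY)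
    (hδ : 0 < δ) (hμF : 0 < μF) (hμM : 0 < μM) (hα : 0 ≤ α) (hYP : 0 < YP)
    (Is Ys Fs : ℝ) (hI : 0 < Is) (hY : 0 < Ys) (hF : 0 < Fs)
    (E0 : b * (1 - Is / K) * Fs = (νI + μI) * Is)
    (E1 : r * νI * Is + δ * Fs = (νY + μY) * Ys)
    (E2 : νY * Ys = (δ + μF) * Fs)
    (x : ℝ → Fin 4 → ℝ)
    (hx : IsSolOn (cAbund b K r νI μI νY μY δ μF μM α YP) Orthant x)
    (hx0 : ¬ (x 0 0 = 0 ∧ x 0 1 = 0 ∧ x 0 2 = 0)) :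
    ∃ m > 0, ∃ B : ℝ, ∀ t, 1 ≤ t →
      (m ≤ x t 0 ∧ m ≤ x t 1 ∧ m ≤ x t 2) ∧ (x t 0 ≤ B ∧ x t 1 ≤ B ∧ x t 2 ≤ B) := by
  obtain ⟨p0, p1, p2⟩ := cab_pos_one b K r νI μI νY μY δ μF μM α YP hb hK hr hr1
    hνI hμI hνY hμY hδ hμF hμM hα hYP x hx hx0
  obtain ⟨hi, h0, hxh, U0, U1, U2, U3⟩ := cab_big b K r νI μI νY μY δ μF μM α YP hb hK hr hr1
    hνI hμI hνY hμY hδ hμF hμM hα hYP (x 1)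
  set θ := min (min 1 (x 1 0 / Is)) (min (x 1 1 / Ys) (x 1 2 / Fs)) with hθ
  have t0 : θ ≤ 1 := (min_le_left _ _).trans (min_le_left _ _)
  have t1 : θ ≤ x 1 0 / Is := (min_le_left _ _).trans (min_le_right _ _)
  have t2 : θ ≤ x 1 1 / Ys := (min_le_right _ _).trans (min_le_left _ _)
  have t3 : θ ≤ x 1 2 / Fs := (min_le_right _ _).trans (min_le_right _ _)
  have tp : 0 < θ := by
    rw [hθ]; refine lt_min (lt_min one_pos ?_) (lt_min ?_ ?_) <;> positivity
  rw [le_div_iff₀ hI] at t1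
  rw [le_div_iff₀ hY] at t2
  rw [le_div_iff₀ hF] at t3
  set lo : Fin 4 → ℝ := ![θ * Is, θ * Ys, θ * Fs, 0] with hlo
  have hlo0 : 0 ≤ lo := by
    intro i
    fin_cases i
    · exact (mul_pos tp hI).le
    · exact (mul_pos tp hY).le
    · exact (mul_pos tp hF).le
    · exact le_rfl
  have hlox : lo ≤ x 1 := by
    intro i
    fin_cases i
    · exact t1
    · exact t2
    · exact t3
    · exact hx.2 1 zero_le_one 3
  have hy : IsSolOn (cAbund b K r νI μI νY μY δ μF μM α YP) Orthant (fun t => x (t + 1)) :=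
    ⟨fun t ht => (hx.1 (t+1) (by linarith)).comp_add_const t 1, fun t ht => hx.2 (t+1) (by linarith)⟩
  have hinv := box_invariant _ lo hi (hlox.trans hxh) hlo0
    (cab_lip b K r νI μI νY μY δ μF μM α YP hYP)
    (cab_lo b K r νI μI νY μY δ μF μM α YP hb hr hr1 hνI hμI hνY hδ hα hYP lo hi hlo0
      (by
        simp [hlo]
        have h1 : θ * ((νI + μI) * Is) = θ * (b * (1 - Is / K) * Fs) := by rw [E0]
        have h2 : 0 ≤ b * (Is / K) * Fs * θ * (1 - θ) :=
          mul_nonneg (by positivity) (by linarith)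
        have e : b * (1 - θ * Is / K) * (θ * Fs) = θ * (b * (1 - Is / K) * Fs) +
          b * (Is / K) * Fs * θ * (1 - θ) := by ring
        linarith)
      (by
        simp [hlo]
        have : θ * (r * νI * Is + δ * Fs) = θ * ((νY + μY) * Ys) := by rw [E1]
        linarith)
      (by
        simp [hlo]
        have : θ * (νY * Ys) = θ * ((δ + μF) * Fs) := by rw [E2]
        linarith)
      (by
        simp [hlo]
        have : 0 < 1 - r := sub_pos.2 hr1
        positivity))
    (cab_hi b K r νI μI νY μY δ μF μM α YP hb hr hr1 hνI hμI hνY hδ hα hYP lo hi hlo0 U0 U1 U2 U3)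
    (fun t => x (t + 1)) hy (by simpa using ⟨hlox, hxh⟩)
  refine ⟨min (θ * Is) (min (θ * Ys) (θ * Fs)), by
    refine lt_min ?_ (lt_min ?_ ?_) <;> positivity, max (hi 0) (max (hi 1) (hi 2)), ?_⟩
  intro t ht
  have h := hinv (t - 1) (by linarith)
  simp only [sub_add_cancel] at h
  have l0 : θ * Is ≤ x t 0 := h.1 0
  have l1 : θ * Ys ≤ x t 1 := h.1 1
  have l2 : θ * Fs ≤ x t 2 := h.1 2
  exact ⟨⟨(min_le_left _ _).trans l0, (min_le_right _ _).trans ((min_le_left _ _).trans l1),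
    (min_le_right _ _).trans ((min_le_right _ _).trans l2)⟩,
    (h.2 0).trans (le_max_left _ _), (h.2 1).trans ((le_max_left _ _).trans (le_max_right _ _)),
    (h.2 2).trans ((le_max_right _ _).trans (le_max_right _ _))⟩

lemma alg_up (b K c a e δ ν ρ Is Ys Fs A0 A1 A2 : ℝ) (hb : 0 < b) (hK : 0 < K) (cp : 0 < c)
    (ap : 0 < a) (hδ : 0 < δ) (hν : 0 < ν) (hρ : 0 < ρ) (hI : 0 < Is) (hF : 0 < Fs)
    (hD : 0 < a * e - δ * ν)
    (E0 : b * (1 - Is / K) * Fs = c * Is) (E1 : ρ * Is + δ * Fs = a * Ys) (E2 : ν * Ys = e * Fs)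
    (A0pos : 0 < A0) (A2pos : 0 < A2)
    (u0' : A0 * (b * A2 / K + c) ≤ b * A2) (u1' : a * A1 ≤ ρ * A0 + δ * A2)
    (u2' : e * A2 ≤ ν * A1) : A0 ≤ Is ∧ A1 ≤ Ys ∧ A2 ≤ Fs := by
  have hDF : (a * e - δ * ν) * Fs = ν * ρ * Is := by
    linear_combination (-ν) * E1 - a * E2
  have uF : A2 * Is ≤ Fs * A0 := by
    have h1 : (a * e - δ * ν) * A2 ≤ ν * ρ * A0 := by
      have k1 := mul_le_mul_of_nonneg_left u1' hν.le
      have k2 := mul_le_mul_of_nonneg_left u2' ap.le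
      linarith
    have h2 : (a * e - δ * ν) * (A2 * Is) ≤ (a * e - δ * ν) * (Fs * A0) := by
      have := mul_le_mul_of_nonneg_right h1 hI.le
      have h3 : (a * e - δ * ν) * Fs * A0 = ν * ρ * Is * A0 := by rw [hDF]
      linarith
    exact le_of_mul_le_mul_left h2 hD
  have hA0 : A0 ≤ Is := by
    by_contra hn
    push Not at hn
    have h1 : c * A0 ≤ b * A2 * (1 - A0 / K) := by
      have : A0 * (b * A2 / K + c) = c * A0 + b * A2 * (A0 / K) := by ring
      linarith
    have h2 : 0 < 1 - A0 / K := by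
      have := (mul_pos cp A0pos).trans_le h1
      exact pos_of_mul_pos_right this (mul_pos hb A2pos).le
    have h3 : c * A0 * Is ≤ b * (Fs * A0) * (1 - A0 / K) := by
      have g1 := mul_le_mul_of_nonneg_right h1 hI.le
      have g2 := mul_le_mul_of_nonneg_left uF (mul_pos hb h2).le
      linarith
    have h4 : A0 / K > Is / K := by gcongr
    have h5 : b * (Fs * A0) * (1 - A0 / K) < b * (Fs * A0) * (1 - Is / K) :=
      mul_lt_mul_of_pos_left (by linarith) (by positivity)
    have h6 : b * (1 - Is / K) * Fs * A0 = c * Is * A0 := by rw [E0]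
    linarith
  have hA2 : A2 ≤ Fs := by
    have : A2 * Is ≤ Fs * Is := uF.trans (mul_le_mul_of_nonneg_left hA0 hF.le)
    exact le_of_mul_le_mul_right this hI
  refine ⟨hA0, ?_, hA2⟩
  have h1 := mul_le_mul_of_nonneg_left hA0 hρ.le
  have h2 := mul_le_mul_of_nonneg_left hA2 hδ.le
  have : a * A1 ≤ a * Ys := by linarith
  exact le_of_mul_le_mul_left this ap

lemma alg_lo (b K c a e δ ν ρ Is Ys Fs C0 C1 C2 : ℝ) (hb : 0 < b) (hK : 0 < K) (cp : 0 < c)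
    (ap : 0 < a) (hδ : 0 < δ) (hν : 0 < ν) (hρ : 0 < ρ) (hI : 0 < Is) (hF : 0 < Fs)
    (hD : 0 < a * e - δ * ν)
    (E0 : b * (1 - Is / K) * Fs = c * Is) (E1 : ρ * Is + δ * Fs = a * Ys) (E2 : ν * Ys = e * Fs)
    (C0pos : 0 < C0)
    (v0' : b * C2 ≤ C0 * (b * C2 / K + c)) (v1' : ρ * C0 + δ * C2 ≤ a * C1)
    (v2' : ν * C1 ≤ e * C2) : Is ≤ C0 ∧ Ys ≤ C1 ∧ Fs ≤ C2 := by
  have hDF : (a * e - δ * ν) * Fs = ν * ρ * Is := by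
    linear_combination (-ν) * E1 - a * E2
  have vF : Fs * C0 ≤ C2 * Is := by
    have h1 : ν * ρ * C0 ≤ (a * e - δ * ν) * C2 := by
      have k1 := mul_le_mul_of_nonneg_left v1' hν.le
      have k2 := mul_le_mul_of_nonneg_left v2' ap.le
      linarith
    have h2 : (a * e - δ * ν) * (Fs * C0) ≤ (a * e - δ * ν) * (C2 * Is) := by
      have := mul_le_mul_of_nonneg_right h1 hI.le
      have h3 : (a * e - δ * ν) * Fs * C0 = ν * ρ * Is * C0 := by rw [hDF]
      linarith
    exact le_of_mul_le_mul_left h2 hD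
  have hIK : 0 < 1 - Is / K := by
    have h : 0 < b * Fs * (1 - Is / K) := by
      have := mul_pos cp hI
      linarith
    exact pos_of_mul_pos_right h (mul_pos hb hF).le
  have hC0 : Is ≤ C0 := by
    by_contra hn
    push Not at hn
    have h1 : b * C2 * (1 - C0 / K) ≤ c * C0 := by
      have : C0 * (b * C2 / K + c) = c * C0 + b * C2 * (C0 / K) := by ring
      linarith
    have h4 : C0 / K < Is / K := by gcongr
    have h2 : 0 < 1 - C0 / K := by linarith
    have h3 : b * (Fs * C0) * (1 - C0 / K) ≤ c * C0 * Is := by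
      have g1 := mul_le_mul_of_nonneg_right h1 hI.le
      have g2 := mul_le_mul_of_nonneg_left vF (mul_pos hb h2).le
      linarith
    have h5 : b * (Fs * C0) * (1 - Is / K) < b * (Fs * C0) * (1 - C0 / K) :=
      mul_lt_mul_of_pos_left (by linarith) (by positivity)
    have h6 : b * (1 - Is / K) * Fs * C0 = c * Is * C0 := by rw [E0]
    linarith
  have hC2 : Fs ≤ C2 := by
    have : Fs * Is ≤ C2 * Is := (mul_le_mul_of_nonneg_left hC0 hF.le).trans vF
    exact le_of_mul_le_mul_right this hI
  refine ⟨hC0, ?_, hC2⟩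
  have h1 := mul_le_mul_of_nonneg_left hC0 hρ.le
  have h2 := mul_le_mul_of_nonneg_left hC2 hδ.le
  have : a * Ys ≤ a * C1 := by linarith
  exact le_of_mul_le_mul_left this ap

set_option maxHeartbeats 2000000 in
lemma cab_conv (b K r νI μI νY μY δ μF μM α YP : ℝ)
    (hb : 0 < b) (hK : 0 < K) (hr : 0 < r) (hr1 : r < 1)
    (hνI : 0 < νI) (hμI : 0 < μI) (hνY : 0 < νY) (hμY : 0 < μY)
    (hδ : 0 < δ) (hμF : 0 < μF) (hμM : 0 < μM) (hα : 0 ≤ α) (hYP : 0 < YP)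
    (Is Ys Fs Ms : ℝ) (hI : 0 < Is) (hY : 0 < Ys) (hF : 0 < Fs)
    (E0 : b * (1 - Is / K) * Fs = (νI + μI) * Is)
    (E1 : r * νI * Is + δ * Fs = (νY + μY) * Ys)
    (E2 : νY * Ys = (δ + μF) * Fs)
    (E3 : (1 - r) * νI * Is = (μM + α * YP / (Ys + YP)) * Ms)
    (x : ℝ → Fin 4 → ℝ)
    (hx : IsSolOn (cAbund b K r νI μI νY μY δ μF μM α YP) Orthant x)
    (hx0 : ¬ (x 0 0 = 0 ∧ x 0 1 = 0 ∧ x 0 2 = 0)) :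
    Tendsto x atTop (𝓝 ![Is, Ys, Fs, Ms]) := by
  obtain ⟨m, hm, B, hmB⟩ := cab_persist b K r νI μI νY μY δ μF μM α YP hb hK hr hr1
    hνI hμI hνY hμY hδ hμF hμM hα hYP Is Ys Fs hI hY hF E0 E1 E2 x hx hx0
  obtain ⟨dI, dY, dF, dM⟩ := cab_comp b K r νI μI νY μY δ μF μM α YP _ x hx
  have n0 : ∀ t, 0 ≤ t → 0 ≤ x t 0 := fun t ht => hx.2 t ht 0
  have n1 : ∀ t, 0 ≤ t → 0 ≤ x t 1 := fun t ht => hx.2 t ht 1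
  have n2 : ∀ t, 0 ≤ t → 0 ≤ x t 2 := fun t ht => hx.2 t ht 2
  set c := νI + μI with hc
  set a := νY + μY with ha
  set e := δ + μF with he
  have cp : 0 < c := by positivity
  have ap : 0 < a := by positivity
  have ep : 0 < e := by positivity
  have hrI : 0 < r * νI := mul_pos hr hνI
  have hD : 0 < a * e - δ * νY := by
    rw [ha, he]; nlinarith [mul_pos hνY hμF, mul_pos hμY hδ, mul_pos hμY hμF]
  -- relaxation forms
  have rI : ∀ t, 0 ≤ t → HasDerivAt (fun t => x t 0)
      ((b * x t 2 / K + c) * (b * x t 2 / (b * x t 2 / K + c) - x t 0)) t := by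
    intro t ht
    refine (dI t ht).congr_deriv ?_
    have : 0 < b * x t 2 / K + c := by
      have := n2 t ht
      positivity
    have h9 := mul_div_cancel₀ (b * x t 2) this.ne'
    rw [mul_sub (b * x t 2 / K + c), h9]
    ring
  have rIh : ∀ t, 0 ≤ t → c ≤ b * x t 2 / K + c := by
    intro t ht
    have := n2 t ht
    have : 0 ≤ b * x t 2 / K := by positivity
    linarith
  have rY : ∀ t, 0 ≤ t → HasDerivAt (fun t => x t 1)
      (a * ((r * νI / a * x t 0 + δ / a * x t 2) - x t 1)) t := by
    intro t ht
    refine (dY t ht).congr_deriv ?_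
    field_simp
    ring
  have rF : ∀ t, 0 ≤ t → HasDerivAt (fun t => x t 2) (e * (νY / e * x t 1 - x t 2)) t := by
    intro t ht
    refine (dF t ht).congr_deriv ?_
    field_simp
  -- upper limits
  obtain ⟨A0, A0p, U0, L0⟩ := EvUB.exists_least (u := fun t => x t 0)
    (fun t ht => (hmB t ht).1.1) (fun t ht => (hmB t ht).2.1)
  obtain ⟨A1, A1p, U1, L1⟩ := EvUB.exists_least (u := fun t => x t 1)
    (fun t ht => (hmB t ht).1.2.1) (fun t ht => (hmB t ht).2.2.1)
  obtain ⟨A2, A2p, U2, L2⟩ := EvUB.exists_least (u := fun t => x t 2)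
    (fun t ht => (hmB t ht).1.2.2) (fun t ht => (hmB t ht).2.2.2)
  have A0pos := hm.trans_le A0p
  have A1pos := hm.trans_le A1p
  have A2pos := hm.trans_le A2p
  have hneg : -(c * K / b) < 0 := by
    have : 0 < c * K / b := by positivity
    linarith
  have u0 : A0 ≤ b * A2 / (b * A2 / K + c) := by
    apply L0
    refine EvUB.relax cp rI rIh ?_
    refine EvUB.comp (φ := fun z => b * z / (b * z / K + c)) U2
      (Ioi_mem_nhds (hneg.trans A2pos)) (phi_mono hb hK cp) ?_ (fun t ht => hneg.trans_le (n2 t ht))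
    have : b * A2 / K + c ≠ 0 := by positivity
    fun_prop (disch := assumption)
  have u1 : A1 ≤ r * νI / a * A0 + δ / a * A2 :=
    L1 _ (EvUB.relax ap rY (fun _ _ => le_rfl) (U0.lin U2 (by positivity) (by positivity)))
  have u2 : A2 ≤ νY / e * A1 :=
    L2 _ (EvUB.relax ep rF (fun _ _ => le_rfl) (U1.smul (by positivity)))
  have u0' : A0 * (b * A2 / K + c) ≤ b * A2 := by
    rwa [le_div_iff₀ (by positivity)] at u0
  have u1' : a * A1 ≤ r * νI * A0 + δ * A2 := by
    have := mul_le_mul_of_nonneg_left u1 ap.le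
    have e1 : a * (r * νI / a * A0 + δ / a * A2) = r * νI * A0 + δ * A2 := by field_simp
    linarith
  have u2' : e * A2 ≤ νY * A1 := by
    have := mul_le_mul_of_nonneg_left u2 ep.le
    have e1 : e * (νY / e * A1) = νY * A1 := by field_simp
    linarith
  obtain ⟨hA0, hA1, hA2⟩ := alg_up b K c a e δ νY (r * νI) Is Ys Fs A0 A1 A2 hb hK cp ap hδ hνY hrI
    hI hF hD E0 E1 E2 A0pos A2pos u0' u1' u2'
  -- lower limits
  obtain ⟨N0, N0p, V0, M0⟩ := EvUB.exists_least (u := fun t => - x t 0) (l := -B) (m := -m)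
    (fun t ht => neg_le_neg (hmB t ht).2.1) (fun t ht => neg_le_neg (hmB t ht).1.1)
  obtain ⟨N1, N1p, V1, M1⟩ := EvUB.exists_least (u := fun t => - x t 1) (l := -B) (m := -m)
    (fun t ht => neg_le_neg (hmB t ht).2.2.1) (fun t ht => neg_le_neg (hmB t ht).1.2.1)
  obtain ⟨N2, N2p, V2, M2⟩ := EvUB.exists_least (u := fun t => - x t 2) (l := -B) (m := -m)
    (fun t ht => neg_le_neg (hmB t ht).2.2.2) (fun t ht => neg_le_neg (hmB t ht).1.2.2)
  have evm : ∀ i : Fin 4, (∀ t, 1 ≤ t → m ≤ x t i) → EvUB (fun t => - x t i) (-m) := by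
    intro i h ε hε
    filter_upwards [eventually_ge_atTop 1] with t ht
    linarith [h t ht]
  have q0 := M0 _ (evm 0 fun t ht => (hmB t ht).1.1)
  have q1 := M1 _ (evm 1 fun t ht => (hmB t ht).1.2.1)
  have q2 := M2 _ (evm 2 fun t ht => (hmB t ht).1.2.2)
  obtain ⟨C0, hC0⟩ : ∃ C0, N0 = -C0 := ⟨-N0, by ring⟩
  obtain ⟨C1, hC1⟩ : ∃ C1, N1 = -C1 := ⟨-N1, by ring⟩
  obtain ⟨C2, hC2⟩ : ∃ C2, N2 = -C2 := ⟨-N2, by ring⟩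
  subst hC0 hC1 hC2
  have C0pos : 0 < C0 := by linarith
  have C1pos : 0 < C1 := by linarith
  have C2pos : 0 < C2 := by linarith
  have v0 : -C0 ≤ -(b * C2 / (b * C2 / K + c)) := by
    apply M0
    refine EvUB.relax_neg cp rI rIh ?_
    have := EvUB.comp (φ := fun z => -(b * (-z) / (b * (-z) / K + c))) V2
      (Iio_mem_nhds (show -C2 < c * K / b by linarith)) (phi_mono_neg hb hK cp) (by
        have : b * (-(-C2)) / K + c ≠ 0 := by rw [neg_neg]; positivity
        fun_prop (disch := assumption)) (fun t ht => by
        have := n2 t ht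
        rw [mem_Iio]; linarith)
    simpa using this
  have v1 : -C1 ≤ r * νI / a * (-C0) + δ / a * (-C2) := by
    apply M1
    refine EvUB.relax_neg ap rY (fun _ _ => le_rfl) ?_
    have := V0.lin V2 (p := r * νI / a) (q := δ / a) (by positivity) (by positivity)
    convert this using 2
    ring
  have v2 : -C2 ≤ νY / e * (-C1) := by
    apply M2
    refine EvUB.relax_neg ep rF (fun _ _ => le_rfl) ?_
    have := V1.smul (p := νY / e) (by positivity)
    convert this using 2
    ring
  have v0' : b * C2 ≤ C0 * (b * C2 / K + c) := by
    have : b * C2 / (b * C2 / K + c) ≤ C0 := by linarith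
    rwa [div_le_iff₀ (by positivity)] at this
  have v1' : r * νI * C0 + δ * C2 ≤ a * C1 := by
    have := mul_le_mul_of_nonneg_left v1 ap.le
    have e1 : a * (r * νI / a * (-C0) + δ / a * (-C2)) = -(r * νI * C0 + δ * C2) := by
      field_simp; ring
    linarith
  have v2' : νY * C1 ≤ e * C2 := by
    have := mul_le_mul_of_nonneg_left v2 ep.le
    have e1 : e * (νY / e * (-C1)) = -(νY * C1) := by field_simp
    linarith
  obtain ⟨hC0, hC1, hC2⟩ := alg_lo b K c a e δ νY (r * νI) Is Ys Fs C0 C1 C2 hb hK cp ap hδ hνY hrI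
    hI hF hD E0 E1 E2 C0pos v0' v1' v2'
  have T0 : Tendsto (fun t => x t 0) atTop (𝓝 Is) :=
    EvUB.tendsto (U0.mono hA0) (V0.mono (neg_le_neg hC0))
  have T1 : Tendsto (fun t => x t 1) atTop (𝓝 Ys) :=
    EvUB.tendsto (U1.mono hA1) (V1.mono (neg_le_neg hC1))
  have T2 : Tendsto (fun t => x t 2) atTop (𝓝 Fs) :=
    EvUB.tendsto (U2.mono hA2) (V2.mono (neg_le_neg hC2))
  have hMh : ∀ t, 0 ≤ t → μM ≤ μM + α * YP / (x t 1 + YP) := by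
    intro t ht
    have := n1 t ht
    have : 0 ≤ α * YP / (x t 1 + YP) := by positivity
    linarith
  have T3 : Tendsto (fun t => x t 3) atTop (𝓝 Ms) := by
    refine relax_tendsto hμM (h := fun t => μM + α * YP / (x t 1 + YP))
      (g := fun t => (1 - r) * νI * x t 0 / (μM + α * YP / (x t 1 + YP))) ?_ hMh ?_
    · intro t ht
      refine (dM t ht).congr_deriv ?_
      have := hμM.trans_le (hMh t ht)
      rw [mul_sub (μM + α * YP / (x t 1 + YP)), mul_div_cancel₀ _ this.ne']
    · have hp : 0 < μM + α * YP / (Ys + YP) := by positivity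
      have : Ms = (1 - r) * νI * Is / (μM + α * YP / (Ys + YP)) := by
        rw [E3]; field_simp
      rw [this]
      refine (T0.const_mul _).div (tendsto_const_nhds.add (tendsto_const_nhds.div
        (T1.add_const YP) (by positivity))) hp.ne'
  rw [tendsto_pi_nhds]
  intro i
  fin_cases i
  · exact T0
  · exact T1
  · exact T2
  · exact T3

set_option maxHeartbeats 2000000 in
lemma cab_stable (b K r νI μI νY μY δ μF μM α YP : ℝ)
    (hb : 0 < b) (hK : 0 < K) (hr : 0 < r) (hr1 : r < 1)
    (hνI : 0 < νI) (hμI : 0 < μI) (hνY : 0 < νY) (hμY : 0 < μY)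
    (hδ : 0 < δ) (hμF : 0 < μF) (hμM : 0 < μM) (hα : 0 ≤ α) (hYP : 0 < YP)
    (Is Ys Fs Ms : ℝ) (hI : 0 < Is) (hY : 0 < Ys) (hF : 0 < Fs) (hM : 0 < Ms)
    (E0 : b * (1 - Is / K) * Fs = (νI + μI) * Is)
    (E1 : r * νI * Is + δ * Fs = (νY + μY) * Ys)
    (E2 : νY * Ys = (δ + μF) * Fs)
    (E3 : (1 - r) * νI * Is = (μM + α * YP / (Ys + YP)) * Ms) :
    StableOn (cAbund b K r νI μI νY μY δ μF μM α YP) Orthant ![Is, Ys, Fs, Ms] := by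
  intro ε hε
  set P := Is + Ys + Fs + Ms with hP
  have Pp : 0 < P := by positivity
  obtain ⟨s, sp, s1, s2⟩ : ∃ s, 0 < s ∧ s ≤ 1/2 ∧ s * (4 * P) ≤ ε := by
    refine ⟨min (1/2) (ε / (4 * P)), lt_min (by norm_num) (by positivity), min_le_left _ _, ?_⟩
    rw [← le_div_iff₀ (by positivity)]
    exact min_le_right _ _
  obtain ⟨d, dp, d0, d1, d2, d3⟩ : ∃ d, 0 < d ∧ d ≤ s * Is ∧ d ≤ s * Ys ∧ d ≤ s * Fs ∧ d ≤ s * Ms :=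
    ⟨min (min (s * Is) (s * Ys)) (min (s * Fs) (s * Ms)),
      lt_min (lt_min (by positivity) (by positivity)) (lt_min (by positivity) (by positivity)),
      (min_le_left _ _).trans (min_le_left _ _), (min_le_left _ _).trans (min_le_right _ _),
      (min_le_right _ _).trans (min_le_left _ _), (min_le_right _ _).trans (min_le_right _ _)⟩
  refine ⟨d, dp, fun x hx hd t ht => ?_⟩
  rw [dist_pi_lt_iff dp] at hd
  have g0 : |x 0 0 - Is| < d := hd 0
  have g1 : |x 0 1 - Ys| < d := hd 1
  have g2 : |x 0 2 - Fs| < d := hd 2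
  have g3 : |x 0 3 - Ms| < d := hd 3
  rw [abs_lt] at g0 g1 g2 g3
  have sM : 0 ≤ s * Ms := by positivity
  have ssM : s * (s * Ms) ≤ 1/2 * (s * Ms) := mul_le_mul_of_nonneg_right s1 sM
  have ssM0 : 0 ≤ s * (s * Ms) := by positivity
  have key : ∀ θ, 0 < θ → ∃ κ, κ = b * (Is / K) * Fs * θ ∧ 0 < κ ∧
      b * (1 - θ * Is / K) * (θ * Fs) = θ * ((νI + μI) * Is) + κ * (1 - θ) := by
    intro θ hθ
    refine ⟨_, rfl, by positivity, ?_⟩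
    rw [← E0]; ring
  have keyM : ∀ θ, 0 < θ → ∃ κ, 0 ≤ κ ∧
      (μM + α * YP / (θ * Ys + YP)) * (θ ^ 2 * Ms) =
        θ * ((1 - r) * νI * Is) + κ * (θ - 1) := by
    intro θ hθ
    refine ⟨θ * Ms * (μM + α * YP * YP / ((θ * Ys + YP) * (Ys + YP))), by positivity, ?_⟩
    rw [E3]
    have h1 : θ * Ys + YP ≠ 0 := by positivity
    have h2 : Ys + YP ≠ 0 := by positivity
    field_simp
    ring
  have hlow : 0 < 1 - s := by linarith
  have hupp : 0 < 1 + s := by linarith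
  set lo : Fin 4 → ℝ := ![(1 - s) * Is, (1 - s) * Ys, (1 - s) * Fs, (1 - s) ^ 2 * Ms] with hlo
  set hi : Fin 4 → ℝ := ![(1 + s) * Is, (1 + s) * Ys, (1 + s) * Fs, (1 + s) ^ 2 * Ms] with hhi
  have hlo0 : 0 ≤ lo := by
    intro i
    fin_cases i
    · exact (mul_pos hlow hI).le
    · exact (mul_pos hlow hY).le
    · exact (mul_pos hlow hF).le
    · exact (mul_pos (pow_pos hlow 2) hM).le
  have hlx : lo ≤ x 0 := by
    intro i
    fin_cases i
    · show (1 - s) * Is ≤ x 0 0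
      linarith
    · show (1 - s) * Ys ≤ x 0 1
      linarith
    · show (1 - s) * Fs ≤ x 0 2
      linarith
    · show (1 - s) ^ 2 * Ms ≤ x 0 3
      linarith
  have hxh : x 0 ≤ hi := by
    intro i
    fin_cases i
    · show x 0 0 ≤ (1 + s) * Is
      linarith
    · show x 0 1 ≤ (1 + s) * Ys
      linarith
    · show x 0 2 ≤ (1 + s) * Fs
      linarith
    · show x 0 3 ≤ (1 + s) ^ 2 * Ms
      linarith
  have hinv := box_invariant _ lo hi (hlx.trans hxh) hlo0
    (cab_lip b K r νI μI νY μY δ μF μM α YP hYP)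
    (cab_lo b K r νI μI νY μY δ μF μM α YP hb hr hr1 hνI hμI hνY hδ hα hYP lo hi hlo0
      (by
        simp [hlo]
        obtain ⟨κ, -, hκ, h⟩ := key (1 - s) hlow
        have := mul_pos hκ sp
        linarith)
      (by
        simp [hlo]
        have : (1 - s) * (r * νI * Is + δ * Fs) = (1 - s) * ((νY + μY) * Ys) := by rw [E1]
        linarith)
      (by
        simp [hlo]
        have : (1 - s) * (νY * Ys) = (1 - s) * ((δ + μF) * Fs) := by rw [E2]
        linarith)
      (by
        simp [hlo]
        obtain ⟨κ, hκ, h⟩ := keyM (1 - s) hlow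
        have := mul_nonneg hκ sp.le
        linarith))
    (cab_hi b K r νI μI νY μY δ μF μM α YP hb hr hr1 hνI hμI hνY hδ hα hYP lo hi hlo0
      (by
        simp [hhi]
        obtain ⟨κ, -, hκ, h⟩ := key (1 + s) hupp
        have := mul_pos hκ sp
        linarith)
      (by
        simp [hhi]
        have : (1 + s) * (r * νI * Is + δ * Fs) = (1 + s) * ((νY + μY) * Ys) := by rw [E1]
        linarith)
      (by
        simp [hhi]
        have : (1 + s) * (νY * Ys) = (1 + s) * ((δ + μF) * Fs) := by rw [E2]
        linarith)
      (by
        simp [hhi]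
        obtain ⟨κ, hκ, h⟩ := keyM (1 + s) hupp
        have := mul_nonneg hκ sp.le
        linarith))
    x hx ⟨hlx, hxh⟩ t ht
  have l0 : (1 - s) * Is ≤ x t 0 := hinv.1 0
  have l1 : (1 - s) * Ys ≤ x t 1 := hinv.1 1
  have l2 : (1 - s) * Fs ≤ x t 2 := hinv.1 2
  have l3 : (1 - s) ^ 2 * Ms ≤ x t 3 := hinv.1 3
  have r0 : x t 0 ≤ (1 + s) * Is := hinv.2 0
  have r1 : x t 1 ≤ (1 + s) * Ys := hinv.2 1
  have r2 : x t 2 ≤ (1 + s) * Fs := hinv.2 2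
  have r3 : x t 3 ≤ (1 + s) ^ 2 * Ms := hinv.2 3
  have z0 := mul_pos sp hI
  have z1 := mul_pos sp hY
  have z2 := mul_pos sp hF
  have z3 := mul_pos sp hM
  have zP : s * (4 * P) = 4 * (s * Is) + 4 * (s * Ys) + 4 * (s * Fs) + 4 * (s * Ms) := by
    rw [hP]; ring
  rw [dist_pi_lt_iff hε]
  intro i
  fin_cases i
  · show |x t 0 - Is| < ε
    rw [abs_lt]; constructor <;> linarith
  · show |x t 1 - Ys| < ε
    rw [abs_lt]; constructor <;> linarith
  · show |x t 2 - Fs| < ε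
    rw [abs_lt]; constructor <;> linarith
  · show |x t 3 - Ms| < ε
    rw [abs_lt]; constructor <;> linarith


/-- (a) The controlled male-abundance system defines a positive dynamical system on ℝ⁴₊;
(b) under `N₀ > 1` and `Y* < γM*`, it has the positive equilibrium
`EE^# = (I*, Y*, F*, M^#(Y_P))`, globally asymptotically stable on
ℝ⁴₊ \ {x : I = Y = F = 0}. -/
theorem controlledAbundance_posDynSys_and_EEsharp
    (b K γ r νI μI νY μY δ μF μM α YP N0 Istar Ystar Fstar Mstar Msharp : ℝ)
    (hb : 0 < b) (hK : 0 < K) (hγ : 0 < γ) (hr : 0 < r) (hr1 : r < 1)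
    (hνI : 0 < νI) (hμI : 0 < μI) (hνY : 0 < νY) (hμY : 0 < μY)
    (hδ : 0 < δ) (hμF : 0 < μF) (hμM : 0 < μM) (hα : 0 ≤ α) (hYP : 0 < YP)
    (hN0 : N0 = b * r * νI * νY / ((μI + νI) * ((νY + μY) * (δ + μF) - δ * νY)))
    (hIs : Istar = (1 - 1 / N0) * K)
    (hYs : Ystar = r * νI * (δ + μF) * Istar / ((νY + μY) * (δ + μF) - δ * νY))
    (hFs : Fstar = r * νI * νY * Istar / ((νY + μY) * (δ + μF) - δ * νY))
    (hMs : Mstar = (1 - r) * νI * Istar / μM)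
    (hMsharp : Msharp = (1 - r) * νI * (Ystar + YP) * Istar /
      (μM * (Ystar + YP) + α * YP)) :
    PositiveDynSys (cAbund b K r νI μI νY μY δ μF μM α YP) Orthant ∧
    (1 < N0 → Ystar < γ * Mstar →
      Msharp = Mstar / (1 + α * YP / (μM * (Ystar + YP))) ∧
      cAbund b K r νI μI νY μY δ μF μM α YP ![Istar, Ystar, Fstar, Msharp] = 0 ∧
      (∀ i, 0 < ![Istar, Ystar, Fstar, Msharp] i) ∧
      GASOn (cAbund b K r νI μI νY μY δ μF μM α YP)
        (Orthant \ {x | x 0 = 0 ∧ x 1 = 0 ∧ x 2 = 0})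
        ![Istar, Ystar, Fstar, Msharp]) := by
  refine ⟨cab_posdyn b K r νI μI νY μY δ μF μM α YP hb hK hr hr1 hνI hμI hνY hμY hδ hμF hμM hα hYP,
    fun h1 _ => ?_⟩
  have hD : 0 < (νY + μY) * (δ + μF) - δ * νY := by
    nlinarith [mul_pos hνY hμF, mul_pos hμY hδ, mul_pos hμY hμF]
  have hr' : 0 < 1 - r := sub_pos.2 hr1
  have hN : 0 < N0 := by linarith
  have hIp : 0 < Istar := by
    rw [hIs]
    have : 1 / N0 < 1 := by rw [div_lt_one hN]; exact h1
    exact mul_pos (by linarith) hK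
  have hIK : 1 - Istar / K = 1 / N0 := by
    rw [hIs]; field_simp; ring
  have hD' : (νY + μY) * (δ + μF) - δ * νY ≠ 0 := hD.ne'
  have hYp : 0 < Ystar := by
    rw [hYs]; exact div_pos (by positivity) hD
  have hFp : 0 < Fstar := by
    rw [hFs]; exact div_pos (by positivity) hD
  have hMp : 0 < Msharp := by
    rw [hMsharp]; positivity
  have E0 : b * (1 - Istar / K) * Fstar = (νI + μI) * Istar := by
    rw [hIK, hN0, hFs]
    generalize (νY + μY) * (δ + μF) - δ * νY = D at hD hD'
    field_simp
    ring
  have E1 : r * νI * Istar + δ * Fstar = (νY + μY) * Ystar := by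
    rw [hYs, hFs]; field_simp; ring
  have E2 : νY * Ystar = (δ + μF) * Fstar := by
    rw [hYs, hFs]
    generalize (νY + μY) * (δ + μF) - δ * νY = D at hD hD'
    field_simp
  have hYne : Ystar + YP ≠ 0 := by positivity
  have hne2 : μM * (Ystar + YP) + α * YP ≠ 0 := by positivity
  have E3 : (1 - r) * νI * Istar = (μM + α * YP / (Ystar + YP)) * Msharp := by
    rw [hMsharp]
    field_simp
  have hzero : cAbund b K r νI μI νY μY δ μF μM α YP ![Istar, Ystar, Fstar, Msharp] = 0 := by
    funext i
    fin_cases i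
    · simp [cAbund]; linarith
    · simp [cAbund]; linarith
    · simp [cAbund]; linarith
    · simp [cAbund]; linarith
  refine ⟨?_, hzero, ?_, hzero, ?_, ?_⟩
  · rw [hMsharp, hMs]
    have : 1 + α * YP / (μM * (Ystar + YP)) = (μM * (Ystar + YP) + α * YP) / (μM * (Ystar + YP)) := by
      field_simp
    rw [this]
    field_simp
  · intro i
    fin_cases i
    · exact hIp
    · exact hYp
    · exact hFp
    · exact hMp
  · intro ε hε
    obtain ⟨d, dp, h⟩ := cab_stable b K r νI μI νY μY δ μF μM α YP hb hK hr hr1 hνI hμI hνY hμY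
      hδ hμF hμM hα hYP Istar Ystar Fstar Msharp hIp hYp hFp hMp E0 E1 E2 E3 ε hε
    exact ⟨d, dp, fun x hx => h x ⟨hx.1, fun t ht => (hx.2 t ht).1⟩⟩
  · intro x hx
    exact cab_conv b K r νI μI νY μY δ μF μM α YP hb hK hr hr1 hνI hμI hνY hμY
      hδ hμF hμM hα hYP Istar Ystar Fstar Msharp hIp hYp hFp E0 E1 E2 E3 x
      ⟨hx.1, fun t ht => (hx.2 t ht).1⟩ (hx.2 0 le_rfl).2
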